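/- Suppose λ := lim_{n→∞} λ(n)/n and ξ := lim_{n→∞} ξ(n)/n exist with ξ > λ, and let z ∈ [0,1] be such that (z,1) ∈ Λ. Then dim_H Λ_{λ,ξ}(z,1) = min{ γ/(1+λ), (γ + (ξ−λ)·log #J₂(b−1)/log b)/(1+ξ) }, where γ = log #J / log b. -/

import Mathlib

open Set Filter Topology MeasureTheory
open scoped ENNReal NNReal Topology

noncomputable section

namespace ShrinkingRect

/-- The real number with 1-indexed base-`b` digit sequence `u` (digit `i` is `u i` for `i ≥ 1`). -/
def val (b : ℕ) (u : ℕ → ℕ) : ℝ := ∑' i : ℕ, (u (i + 1) : ℝ) / (b : ℝ) ^ (i + 1)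

/-- The self-similar carpet `Λ` with digit set `J ⊆ {0,…,b−1}²`. -/
def carpet (b : ℕ) (J : Finset (ℕ × ℕ)) : Set (ℝ × ℝ) :=
  {p | ∃ d : ℕ → ℕ × ℕ, (∀ i, 1 ≤ i → d i ∈ J) ∧
    p = (val b (fun i => (d i).1), val b (fun i => (d i).2))}

/-- `J₂(a)`: the digits of `J` lying in row `a`. -/
def J2 (J : Finset (ℕ × ℕ)) (a : ℕ) : Finset (ℕ × ℕ) := J.filter fun p => p.2 = a

/-- The contraction `f_{u,v}(x,y) = ((x+u)/b, (y+v)/b)`. -/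
def fmap (b : ℕ) (uv : ℕ × ℕ) (p : ℝ × ℝ) : ℝ × ℝ :=
  ((p.1 + (uv.1 : ℝ)) / b, (p.2 + (uv.2 : ℝ)) / b)

/-- `f_t = f_{u₁,v₁} ∘ ⋯ ∘ f_{uₙ,vₙ}` for a finite word `t = ((u₁,v₁),…,(uₙ,vₙ))`. -/
def fword (b : ℕ) (t : List (ℕ × ℕ)) (p : ℝ × ℝ) : ℝ × ℝ :=
  t.foldr (fmap b) p

/-- The limsup set `W_{λ,ξ}(z,w)`. -/
def Wset (b : ℕ) (J : Finset (ℕ × ℕ)) (lam xi : ℕ → ℕ) (z w : ℝ) : Set (ℝ × ℝ) :=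
  {p | p ∈ carpet b J ∧
    {t : List (ℕ × ℕ) | t ≠ [] ∧ (∀ e ∈ t, e ∈ J) ∧
      |p.1 - (fword b t (z, w)).1| ≤ (b : ℝ) ^ (-(lam t.length : ℤ) - (t.length : ℤ)) ∧
      |p.2 - (fword b t (z, w)).2| ≤ (b : ℝ) ^ (-(xi t.length : ℤ) - (t.length : ℤ))}.Infinite}

/-- The closeness condition (in one coordinate) defining `M_n(z,w)`:
`xd` is the digit string of the point, `zd` that of the centre, `L` is `λ(n)` or `ξ(n)`. -/
def closeCond (b L n : ℕ) (zd xd : ℕ → ℕ) : Prop :=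
  (∀ i, 1 ≤ i → i < L → xd (i + n) = zd i) ∨
  (∃ j, 1 ≤ j ∧ j < L ∧ (∀ i, 1 ≤ i → i ≤ j - 1 → xd (i + n) = zd i) ∧
    (((xd (j + n) : ℤ) - (zd j : ℤ) = -1 ∧
        ∀ i, j + 1 ≤ i → i < L → (xd (i + n) : ℤ) - (zd i : ℤ) = (b : ℤ) - 1) ∨
     ((xd (j + n) : ℤ) - (zd j : ℤ) = 1 ∧
        ∀ i, j + 1 ≤ i → i < L → (zd i : ℤ) - (xd (i + n) : ℤ) = (b : ℤ) - 1)))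

/-- A choice of representative digit sequences for the points of the carpet: each point of `Λ`
gets a digit sequence in `J` representing it, whose partial products of row cardinalities
`∏ #J₂(y_i)` are eventually maximal among all representations of that point. -/
structure RepMap (b : ℕ) (J : Finset (ℕ × ℕ)) where
  rep : ℝ × ℝ → ℕ → ℕ × ℕ
  mem_J : ∀ p ∈ carpet b J, ∀ i, 1 ≤ i → rep p i ∈ J
  eq_val : ∀ p ∈ carpet b J,
    p = (val b (fun i => (rep p i).1), val b (fun i => (rep p i).2))
  maximal : ∀ p ∈ carpet b J, ∀ d : ℕ → ℕ × ℕ, (∀ i, 1 ≤ i → d i ∈ J) →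
    p = (val b (fun i => (d i).1), val b (fun i => (d i).2)) →
    ∃ N₀ : ℕ, ∀ N, N₀ ≤ N →
      ∏ i ∈ Finset.Icc 1 N, (J2 J (d i).2).card ≤
        ∏ i ∈ Finset.Icc 1 N, (J2 J (rep p i).2).card

/-- The expanding map `T(x,y) = (bx − x₁, by − y₁)`, where `(x_i,y_i)` is the representative
digit sequence of `(x,y)`. -/
def Tmap {b : ℕ} {J : Finset (ℕ × ℕ)} (R : RepMap b J) (p : ℝ × ℝ) : ℝ × ℝ :=
  ((b : ℝ) * p.1 - ((R.rep p 1).1 : ℝ), (b : ℝ) * p.2 - ((R.rep p 1).2 : ℝ))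

/-- The shrinking target set `Λ_{λ,ξ}(z,w)`. -/
def targetSet {b : ℕ} {J : Finset (ℕ × ℕ)} (R : RepMap b J) (lam xi : ℕ → ℕ)
    (z w : ℝ) : Set (ℝ × ℝ) :=
  {p | p ∈ carpet b J ∧ ∃ᶠ n in atTop,
    ((Tmap R)^[n] p).1 ∈ Icc (z - (b : ℝ) ^ (-(lam n : ℤ))) (z + (b : ℝ) ^ (-(lam n : ℤ))) ∧
    ((Tmap R)^[n] p).2 ∈ Icc (w - (b : ℝ) ^ (-(xi n : ℤ))) (w + (b : ℝ) ^ (-(xi n : ℤ)))}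

/-- The set `M_n(z,w)` (as a set of points of `Λ`, via representative sequences). -/
def Mset {b : ℕ} {J : Finset (ℕ × ℕ)} (R : RepMap b J) (lam xi : ℕ → ℕ)
    (zw : ℝ × ℝ) (n : ℕ) : Set (ℝ × ℝ) :=
  {p | p ∈ carpet b J ∧
    closeCond b (lam n) n (fun i => (R.rep zw i).1) (fun i => (R.rep p i).1) ∧
    closeCond b (xi n) n (fun i => (R.rep zw i).2) (fun i => (R.rep p i).2)}

/-- `p_{n,j}(a,y) = #{λ(n) ≤ i ≤ j : y_{i+n} = a}`. -/
def pcount {b : ℕ} {J : Finset (ℕ × ℕ)} (R : RepMap b J) (lam : ℕ → ℕ)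
    (p : ℝ × ℝ) (a n j : ℕ) : ℕ :=
  ((Finset.Icc (lam n) j).filter fun i => (R.rep p (i + n)).2 = a).card

/-- `A_{n,j}(z,w) = max_{(x,y) ∈ M_n(z,w)} Σ_a p_{n,j}(a,y) log #J₂(a)`. -/
def Aval {b : ℕ} {J : Finset (ℕ × ℕ)} (R : RepMap b J) (lam xi : ℕ → ℕ)
    (zw : ℝ × ℝ) (n j : ℕ) : ℝ :=
  sSup ((fun p => ∑ a ∈ Finset.range b,
    (pcount R lam p a n j : ℝ) * Real.log ((J2 J a).card)) '' Mset R lam xi zw n)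

/-- `s_n = min{ (n log #J + A_{n,j}(z,w)) / ((n+j) log b) : λ(n) ≤ j ≤ ξ(n) }`. -/
def sval {b : ℕ} {J : Finset (ℕ × ℕ)} (R : RepMap b J) (lam xi : ℕ → ℕ)
    (zw : ℝ × ℝ) (n : ℕ) : ℝ :=
  sInf ((fun j : ℕ => ((n : ℝ) * Real.log J.card + Aval R lam xi zw n j) /
    (((n : ℝ) + (j : ℝ)) * Real.log b)) '' Set.Icc (lam n) (xi n))

/-- `#{1 ≤ i ≤ n : u i = a}`. -/
def freqCount (u : ℕ → ℕ) (a n : ℕ) : ℕ := ((Finset.Icc 1 n).filter fun i => u i = a).card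

/-- The second-coordinate digit string of the representative sequence of a point. -/
def wdig {b : ℕ} {J : Finset (ℕ × ℕ)} (R : RepMap b J) (zw : ℝ × ℝ) (i : ℕ) : ℕ :=
  (R.rep zw i).2

/-- The integer with base-`b` digits `u 1, …, u N`, most significant digit first. -/
def pre (b : ℕ) (u : ℕ → ℕ) : ℕ → ℕ
  | 0 => 0
  | N + 1 => b * pre b u N + u (N + 1)

/-- The point of the plane with digit sequence `d`. -/
def point (b : ℕ) (d : ℕ → ℕ × ℕ) : ℝ × ℝ :=
  (val b (fun i => (d i).1), val b (fun i => (d i).2))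

section Digits

variable {b : ℕ} {u v : ℕ → ℕ}

lemma summable_digits (hb : 2 ≤ b) (hu : ∀ i, 1 ≤ i → u i < b) :
    Summable fun i : ℕ => (u (i + 1) : ℝ) / (b : ℝ) ^ (i + 1) := by
  have hb1 : (1 : ℝ) < b := by exact_mod_cast hb
  have hb0 : (0 : ℝ) < b := by linarith
  refine Summable.of_nonneg_of_le (fun i => by positivity) (fun i => ?_)
    (summable_geometric_of_lt_one (inv_nonneg.2 hb0.le) (inv_lt_one_of_one_lt₀ hb1))
  have h : (u (i + 1) : ℝ) ≤ b := by exact_mod_cast (hu (i + 1) (by omega)).le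
  rw [inv_pow, div_le_iff₀ (by positivity), pow_succ, inv_mul_cancel_left₀ (by positivity)]
  exact h

lemma val_nonneg (b : ℕ) (u : ℕ → ℕ) : 0 ≤ val b u :=
  tsum_nonneg fun _ => by positivity

lemma mul_val (hb : 2 ≤ b) (hu : ∀ i, 1 ≤ i → u i < b) :
    (b : ℝ) * val b u = u 1 + val b (fun i => u (i + 1)) := by
  have hb0 : (b : ℝ) ≠ 0 := by positivity
  rw [val, (summable_digits hb hu).tsum_eq_zero_add, mul_add, val, ← tsum_mul_left]
  congr 1
  · rw [zero_add, pow_one, mul_div_cancel₀ _ hb0]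
  · refine tsum_congr fun i => ?_
    rw [pow_succ]
    field_simp

lemma val_le_one (hb : 2 ≤ b) (hu : ∀ i, 1 ≤ i → u i < b) : val b u ≤ 1 := by
  have hb1 : (1 : ℝ) < b := by exact_mod_cast hb
  have hb0 : (0 : ℝ) < b := by linarith
  have hg : HasSum (fun i : ℕ => ((b : ℝ) - 1) / b * ((b : ℝ)⁻¹) ^ i) 1 := by
    have h := (hasSum_geometric_of_lt_one (inv_nonneg.2 hb0.le)
      (inv_lt_one_of_one_lt₀ hb1)).mul_left (((b : ℝ) - 1) / b)
    have h1 : (b : ℝ) - 1 ≠ 0 := by linarith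
    rwa [show ((b : ℝ) - 1) / b * (1 - (b : ℝ)⁻¹)⁻¹ = 1 by
      rw [show 1 - (b : ℝ)⁻¹ = (b - 1) / b by field_simp, mul_inv_cancel₀ (by positivity)]] at h
  refine hasSum_le (fun i => ?_) (summable_digits hb hu).hasSum hg
  have h : (u (i + 1) : ℝ) ≤ b - 1 := by
    have : (u (i + 1) : ℝ) + 1 ≤ b := by exact_mod_cast hu (i + 1) (by omega)
    linarith
  rw [inv_pow, ← div_eq_mul_inv, div_div, ← pow_succ']
  gcongr

lemma pow_mul_val (hb : 2 ≤ b) (hu : ∀ i, 1 ≤ i → u i < b) (N : ℕ) :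
    (b : ℝ) ^ N * val b u = pre b u N + val b (fun i => u (i + N)) := by
  induction N with
  | zero => simp [pre]
  | succ N ih =>
    have h := mul_val (u := fun i => u (i + N)) hb (fun i hi => hu _ (by omega))
    rw [pow_succ', mul_assoc, ih, mul_add, h, pre, Nat.add_comm N 1]
    simp only [add_assoc, Nat.cast_add, Nat.cast_mul]

lemma pre_le_pow_mul_val (hb : 2 ≤ b) (hu : ∀ i, 1 ≤ i → u i < b) (N : ℕ) :
    (pre b u N : ℝ) ≤ (b : ℝ) ^ N * val b u := by
  rw [pow_mul_val hb hu]
  linarith [val_nonneg b (fun i => u (i + N))]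

lemma pow_mul_val_le_pre_add_one (hb : 2 ≤ b) (hu : ∀ i, 1 ≤ i → u i < b) (N : ℕ) :
    (b : ℝ) ^ N * val b u ≤ pre b u N + 1 := by
  rw [pow_mul_val hb hu]
  linarith [val_le_one (u := fun i => u (i + N)) hb (fun i hi => hu _ (by omega))]

lemma pre_congr {N : ℕ} (h : ∀ i, 1 ≤ i → i ≤ N → u i = v i) : pre b u N = pre b v N := by
  induction N with
  | zero => rfl
  | succ N ih => rw [pre, pre, ih fun i h1 h2 => h i h1 (by omega), h _ (by omega) le_rfl]

lemma eq_of_pre_eq {N : ℕ} (hu : ∀ i, 1 ≤ i → u i < b) (hv : ∀ i, 1 ≤ i → v i < b)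
    (h : pre b u N = pre b v N) : ∀ i, 1 ≤ i → i ≤ N → u i = v i := by
  induction N with
  | zero => intro i h1 h2; omega
  | succ N ih =>
    rw [pre, pre] at h
    have h1 := hu (N + 1) (by omega)
    have h2 := hv (N + 1) (by omega)
    have hmod := congrArg (· % b) h
    simp only [Nat.mul_add_mod, Nat.mod_eq_of_lt h1, Nat.mod_eq_of_lt h2] at hmod
    have hpre : pre b u N = pre b v N := by
      rw [hmod] at h
      exact Nat.eq_of_mul_eq_mul_left (by omega) (Nat.add_right_cancel h)
    intro i hi hiN
    rcases Nat.lt_or_ge N i with hlt | hge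
    · rw [show i = N + 1 by omega, hmod]
    · exact ih hpre i hi hge

lemma pre_add (b : ℕ) (u : ℕ → ℕ) (M N : ℕ) :
    pre b u (M + N) = b ^ N * pre b u M + pre b (fun i => u (i + M)) N := by
  induction N with
  | zero => simp [pre]
  | succ N ih =>
    rw [← add_assoc, pre, ih, pre, pow_succ, show N + 1 + M = M + N + 1 by omega]
    ring

lemma pre_const_pred (hb : 2 ≤ b) (N : ℕ) : pre b (fun _ => b - 1) N + 1 = b ^ N := by
  obtain ⟨c, rfl⟩ : ∃ c, b = c + 1 := ⟨b - 1, by omega⟩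
  induction N with
  | zero => simp [pre]
  | succ N ih =>
    rw [pre, pow_succ, ← ih, Nat.add_sub_cancel]
    ring

lemma pre_lt_pow (hu : ∀ i, 1 ≤ i → u i < b) (N : ℕ) : pre b u N < b ^ N := by
  induction N with
  | zero => simp [pre]
  | succ N ih =>
    rw [pre, pow_succ']
    have h := hu (N + 1) (by omega)
    calc b * pre b u N + u (N + 1) < b * pre b u N + b := by omega
      _ = b * (pre b u N + 1) := by ring
      _ ≤ b * b ^ N := Nat.mul_le_mul_left _ ih

/-- A number within less than `b⁻ᴺ` of `1` starts with `N` digits `b - 1`. -/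
lemma digit_eq_pred_of_lt (hb : 2 ≤ b) (hu : ∀ i, 1 ≤ i → u i < b) {N : ℕ}
    (h : (b : ℝ) ^ N - 1 < (b : ℝ) ^ N * val b u) : ∀ i, 1 ≤ i → i ≤ N → u i = b - 1 := by
  refine eq_of_pre_eq (v := fun _ => b - 1) hu (fun _ _ => by omega) ?_
  have h1 := pow_mul_val_le_pre_add_one hb hu N
  have h2 : b ^ N < pre b u N + 2 := by
    have : (b : ℝ) ^ N < pre b u N + 2 := by linarith
    exact_mod_cast this
  have h3 := pre_lt_pow hu N
  have h4 := pre_const_pred hb N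
  omega

lemma digit_eq_pred_of_val_eq_one (hb : 2 ≤ b) (hu : ∀ i, 1 ≤ i → u i < b) (h : val b u = 1) :
    ∀ i, 1 ≤ i → u i = b - 1 := fun i hi =>
  digit_eq_pred_of_lt (N := i) hb hu (by rw [h]; linarith) i hi le_rfl

lemma digit_eq_zero_of_val_eq_zero (hb : 2 ≤ b) (hu : ∀ i, 1 ≤ i → u i < b) (h : val b u = 0) :
    ∀ i, 1 ≤ i → u i = 0 := by
  intro i hi
  refine eq_of_pre_eq (v := fun _ => 0) (N := i) hu (fun _ _ => by omega) ?_ i hi le_rfl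
  have h1 := pre_le_pow_mul_val hb hu i
  rw [h, mul_zero] at h1
  have h2 : pre b u i = 0 := by exact_mod_cast le_antisymm h1 (Nat.cast_nonneg _)
  rw [h2]
  clear h1 h2 hi
  induction i with
  | zero => rfl
  | succ i ih => rw [pre, ← ih, mul_zero]

lemma abs_val_sub_val_le (hb : 2 ≤ b) (hu : ∀ i, 1 ≤ i → u i < b) (hv : ∀ i, 1 ≤ i → v i < b)
    {N : ℕ} (h : ∀ i, 1 ≤ i → i ≤ N → u i = v i) :
    |val b u - val b v| ≤ (b : ℝ) ^ (-(N : ℤ)) := by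
  have hpos : (0 : ℝ) < (b : ℝ) ^ N := by positivity
  have h1 := pre_le_pow_mul_val hb hu N
  have h2 := pow_mul_val_le_pre_add_one hb hu N
  have h3 := pre_le_pow_mul_val hb hv N
  have h4 := pow_mul_val_le_pre_add_one hb hv N
  rw [pre_congr h] at h1 h2
  rw [zpow_neg, zpow_natCast, ← one_div, le_div_iff₀ hpos]
  nth_rw 1 [← abs_of_pos hpos]
  rw [← abs_mul, abs_le]
  constructor <;> nlinarith

/-- Digit sequences that are not eventually constant are determined by their value. -/
lemma first_digit_eq (hb : 2 ≤ b) (hu : ∀ i, 1 ≤ i → u i < b) (hv : ∀ i, 1 ≤ i → v i < b)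
    (hnc : ∀ c, ∃ i, 2 ≤ i ∧ u i ≠ c) (h : val b u = val b v) : u 1 = v 1 := by
  have hu' : ∀ i, 1 ≤ i → u (i + 1) < b := fun i _ => hu _ (by omega)
  have hv' : ∀ i, 1 ≤ i → v (i + 1) < b := fun i _ => hv _ (by omega)
  have h1 := mul_val hb hu
  rw [h, mul_val hb hv] at h1
  have a0 := val_nonneg b (fun i => u (i + 1))
  have a1 := val_le_one hb hu'
  have b0 := val_nonneg b (fun i => v (i + 1))
  have b1 := val_le_one hb hv'
  rcases lt_trichotomy (u 1) (v 1) with hlt | heq | hgt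
  · exfalso
    have : (u 1 : ℝ) + 1 ≤ v 1 := by exact_mod_cast hlt
    have hval : val b (fun i => u (i + 1)) = 1 := by linarith
    obtain ⟨i, hi, hne⟩ := hnc (b - 1)
    have := digit_eq_pred_of_val_eq_one hb hu' hval (i - 1) (by omega)
    exact hne (by rwa [show i - 1 + 1 = i by omega] at this)
  · exact heq
  · exfalso
    have : (v 1 : ℝ) + 1 ≤ u 1 := by exact_mod_cast hgt
    have hval : val b (fun i => u (i + 1)) = 0 := by linarith
    obtain ⟨i, hi, hne⟩ := hnc 0
    have := digit_eq_zero_of_val_eq_zero hb hu' hval (i - 1) (by omega)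
    exact hne (by rwa [show i - 1 + 1 = i by omega] at this)

lemma digits_eq (hb : 2 ≤ b) (hu : ∀ i, 1 ≤ i → u i < b) (hv : ∀ i, 1 ≤ i → v i < b)
    (hnc : ∀ c, ∃ᶠ i in atTop, u i ≠ c) (h : val b u = val b v) : ∀ i, 1 ≤ i → u i = v i := by
  have key : ∀ (n : ℕ) (u v : ℕ → ℕ), (∀ i, 1 ≤ i → u i < b) → (∀ i, 1 ≤ i → v i < b) →
      (∀ c, ∃ᶠ i in atTop, u i ≠ c) → val b u = val b v → u (n + 1) = v (n + 1) := by
    intro n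
    induction n with
    | zero =>
      intro u v hu hv hnc h
      exact first_digit_eq hb hu hv (fun c => (frequently_atTop.1 (hnc c)) 2) h
    | succ n ih =>
      intro u v hu hv hnc h
      refine ih (fun i => u (i + 1)) (fun i => v (i + 1)) (fun i _ => hu _ (by omega))
        (fun i _ => hv _ (by omega)) (fun c => ?_) ?_
      · refine frequently_atTop.2 fun a => ?_
        obtain ⟨i, hi, hne⟩ := (frequently_atTop.1 (hnc c)) (a + 1)
        exact ⟨i - 1, by omega, by rwa [show i - 1 + 1 = i by omega]⟩
      · have h1 := mul_val hb hu
        rw [h, mul_val hb hv,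
          first_digit_eq hb hu hv (fun c => (frequently_atTop.1 (hnc c)) 2) h] at h1
        linarith
  intro i hi
  have := key (i - 1) u v hu hv hnc h
  rwa [show i - 1 + 1 = i by omega] at this

end Digits

section Dynamics

variable {b : ℕ} {J : Finset (ℕ × ℕ)}

lemma point_mem_carpet {d : ℕ → ℕ × ℕ} (hd : ∀ i, 1 ≤ i → d i ∈ J) : point b d ∈ carpet b J :=
  ⟨d, hd, rfl⟩

lemma Tmap_eq_point (hb : 2 ≤ b) (hJ : ∀ e ∈ J, e.1 < b ∧ e.2 < b) (R : RepMap b J)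
    {p : ℝ × ℝ} (hp : p ∈ carpet b J) : Tmap R p = point b (fun i => R.rep p (i + 1)) := by
  have hmem := R.mem_J p hp
  have h := R.eq_val p hp
  have h1 := mul_val (u := fun i => (R.rep p i).1) hb fun i hi => (hJ _ (hmem i hi)).1
  have h2 := mul_val (u := fun i => (R.rep p i).2) hb fun i hi => (hJ _ (hmem i hi)).2
  have e1 : p.1 = val b (fun i => (R.rep p i).1) := congrArg Prod.fst h
  have e2 : p.2 = val b (fun i => (R.rep p i).2) := congrArg Prod.snd h
  rw [← e1] at h1
  rw [← e2] at h2
  ext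
  · simp only [Tmap, point, h1, add_sub_cancel_left]
  · simp only [Tmap, point, h2, add_sub_cancel_left]

/-- Every finite piece of a `T`-orbit is the shift of a digit sequence of the starting point. -/
lemma exists_digits_orbit (hb : 2 ≤ b) (hJ : ∀ e ∈ J, e.1 < b ∧ e.2 < b) (R : RepMap b J)
    (n : ℕ) {p : ℝ × ℝ} (hp : p ∈ carpet b J) :
    ∃ d : ℕ → ℕ × ℕ, (∀ i, 1 ≤ i → d i ∈ J) ∧ p = point b d ∧
      (Tmap R)^[n] p = point b (fun i => d (i + n)) := by
  induction n generalizing p with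
  | zero =>
    obtain ⟨d, hd, h⟩ := hp
    exact ⟨d, hd, h, h⟩
  | succ n ih =>
    have hT : Tmap R p ∈ carpet b J := by
      rw [Tmap_eq_point hb hJ R hp]
      exact point_mem_carpet fun i _ => R.mem_J p hp _ (by omega)
    obtain ⟨d, hd, hTd, hn⟩ := ih hT
    let d' : ℕ → ℕ × ℕ := fun i => if i ≤ 1 then R.rep p 1 else d (i - 1)
    have hd' : ∀ i, 1 ≤ i → d' i ∈ J := by
      intro i hi
      simp only [d']
      split_ifs
      · exact R.mem_J p hp 1 le_rfl
      · exact hd _ (by omega)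
    have hshift : ∀ i, 1 ≤ i → d' (i + 1) = d i := by
      intro i hi
      simp only [d']
      rw [if_neg (by omega), Nat.add_sub_cancel]
    have hval : ∀ (f : ℕ × ℕ → ℕ) (m : ℕ), val b (fun i => f (d' (i + (m + 1)))) =
        val b (fun i => f (d (i + m))) := by
      intro f m
      refine tsum_congr fun i => ?_
      beta_reduce
      rw [show i + 1 + (m + 1) = i + 1 + m + 1 by omega, hshift _ (by omega)]
    have hb0 : (b : ℝ) ≠ 0 := by positivity
    refine ⟨d', hd', ?_, ?_⟩
    · have h1 := mul_val (u := fun i => (d' i).1) hb fun i hi => (hJ _ (hd' i hi)).1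
      have h2 := mul_val (u := fun i => (d' i).2) hb fun i hi => (hJ _ (hd' i hi)).2
      have e1 := hval Prod.fst 0
      have e2 := hval Prod.snd 0
      simp only [zero_add, add_zero] at e1 e2
      rw [e1] at h1
      rw [e2] at h2
      have t1 : (b : ℝ) * p.1 - ((R.rep p 1).1 : ℝ) = val b (fun i => (d i).1) :=
        congrArg Prod.fst hTd
      have t2 : (b : ℝ) * p.2 - ((R.rep p 1).2 : ℝ) = val b (fun i => (d i).2) :=
        congrArg Prod.snd hTd
      have hd1 : d' 1 = R.rep p 1 := if_pos le_rfl
      rw [hd1] at h1 h2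
      ext
      · exact mul_left_cancel₀ hb0 (show (b : ℝ) * p.1 = b * val b (fun i => (d' i).1) by linarith)
      · exact mul_left_cancel₀ hb0 (show (b : ℝ) * p.2 = b * val b (fun i => (d' i).2) by linarith)
    · rw [Function.iterate_succ_apply, hn]
      exact (Prod.ext (hval Prod.fst n) (hval Prod.snd n)).symm

/-- A sequence in which every digit of `J` recurs is the only `J`-sequence of its point. -/
lemma coord_digits_eq (hb : 2 ≤ b) {f : ℕ × ℕ → ℕ} (hJ : ∀ e ∈ J, f e < b)
    {d r : ℕ → ℕ × ℕ} (hd : ∀ i, 1 ≤ i → d i ∈ J) (hr : ∀ i, 1 ≤ i → r i ∈ J)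
    (hrec : ∀ e ∈ J, ∃ᶠ i in atTop, d i = e)
    (h : val b (fun i => f (d i)) = val b (fun i => f (r i))) :
    ∀ i, 1 ≤ i → f (d i) = f (r i) := by
  by_cases hconst : ∀ e ∈ J, ∀ e' ∈ J, f e = f e'
  · exact fun i hi => hconst _ (hd i hi) _ (hr i hi)
  · push Not at hconst
    obtain ⟨e, he, e', he', hne⟩ := hconst
    refine digits_eq hb (fun i hi => hJ _ (hd i hi)) (fun i hi => hJ _ (hr i hi)) (fun c => ?_) h
    by_cases hc : f e = c
    · exact (hrec e' he').mono fun i hi => by rw [hi, ← hc]; exact hne.symm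
    · exact (hrec e he).mono fun i hi => by rwa [hi]

/-- The `T`-orbit of a point in whose digit sequence every digit of `J` recurs. -/
lemma iterate_Tmap_point (hb : 2 ≤ b) (hJ : ∀ e ∈ J, e.1 < b ∧ e.2 < b) (R : RepMap b J)
    {d : ℕ → ℕ × ℕ} (hd : ∀ i, 1 ≤ i → d i ∈ J) (hrec : ∀ e ∈ J, ∃ᶠ i in atTop, d i = e)
    (n : ℕ) : (Tmap R)^[n] (point b d) = point b (fun i => d (i + n)) := by
  induction n generalizing d with
  | zero => rfl
  | succ n ih =>
    have hp : point b d ∈ carpet b J := point_mem_carpet hd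
    have hr := R.mem_J _ hp
    have h := R.eq_val _ hp
    have h1 := coord_digits_eq hb (fun e he => (hJ e he).1) hd hr hrec (congrArg Prod.fst h)
    have h2 := coord_digits_eq hb (fun e he => (hJ e he).2) hd hr hrec (congrArg Prod.snd h)
    have hT : Tmap R (point b d) = point b (fun i => d (i + 1)) := by
      rw [Tmap_eq_point hb hJ R hp]
      refine Prod.ext (tsum_congr fun i => ?_) (tsum_congr fun i => ?_)
      · simp only [h1 (i + 1 + 1) (by omega)]
      · simp only [h2 (i + 1 + 1) (by omega)]
    rw [Function.iterate_succ_apply, hT, ih (fun i _ => hd _ (by omega))]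
    · simp only [add_assoc]
    · intro e he
      refine frequently_atTop.2 fun a => ?_
      obtain ⟨i, hi, hie⟩ := (frequently_atTop.1 (hrec e he)) (a + 1)
      exact ⟨i - 1, by omega, by rwa [show i - 1 + 1 = i by omega]⟩

end Dynamics

section UpperBound

/-- A limsup set of balls whose radii have summable `s`-th powers has dimension at most `s`. -/
lemma dimH_le_of_frequently_dist_le {X : Type*} [MetricSpace X] (S : Set X) (F : ℕ → Finset X)
    (r : ℕ → ℝ) (hr : ∀ n, 0 ≤ r n) (hr0 : Tendsto r atTop (𝓝 0)) (s : ℝ≥0)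
    (hS : ∀ p ∈ S, ∃ᶠ n in atTop, ∃ c ∈ F n, dist p c ≤ r n)
    (hsum : Summable fun n => ((F n).card : ℝ) * (r n) ^ (s : ℝ)) : dimH S ≤ s := by
  borelize X
  refine dimH_le_of_hausdorffMeasure_ne_top (ne_of_eq_of_ne ?_ ENNReal.zero_ne_top)
  let δ : ℕ → ℝ≥0∞ := fun n => ENNReal.ofReal (2 * r n)
  have hδ : Tendsto δ atTop (𝓝 0) := by
    have := ENNReal.tendsto_ofReal (hr0.const_mul 2)
    rwa [mul_zero, ENNReal.ofReal_zero] at this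
  have hdiam : ∀ (x : X) (n : ℕ), Metric.ediam (Metric.closedBall x (r n)) ≤ δ n := by
    intro x n
    refine Metric.ediam_le_of_forall_dist_le fun y hy y' hy' => ?_
    linarith [dist_triangle_right y y' x, Metric.mem_closedBall.1 hy, Metric.mem_closedBall.1 hy']
  let g : ℕ → ℝ≥0∞ := fun n => (F n).card * δ n ^ (s : ℝ)
  have hg : ∑' n, g n ≠ ⊤ := by
    have h2 : ∀ n, g n = ENNReal.ofReal (2 ^ (s : ℝ) * (((F n).card : ℝ) * (r n) ^ (s : ℝ))) := by
      intro n
      have := hr n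
      simp only [g, δ]
      rw [ENNReal.ofReal_rpow_of_nonneg (by positivity) s.coe_nonneg, ← ENNReal.ofReal_natCast,
        ← ENNReal.ofReal_mul (by positivity), Real.mul_rpow zero_le_two this]
      ring_nf
    simp_rw [h2]
    exact (hsum.mul_left _).tsum_ofReal_ne_top
  have htail := ENNReal.tendsto_sum_nat_add g hg
  have hsup : Tendsto (fun N => ⨆ k, δ (k + N)) atTop (𝓝 0) := by
    rw [ENNReal.tendsto_atTop_zero] at hδ ⊢
    intro ε hε
    obtain ⟨N, hN⟩ := hδ ε hε
    exact ⟨N, fun n hn => iSup_le fun k => hN _ (by omega)⟩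
  have hcover := Measure.hausdorffMeasure_le_liminf_tsum (ι := fun N => (k : ℕ) × F (k + N))
    (s : ℝ) S _ hsup (fun N i => Metric.closedBall (i.2 : X) (r (i.1 + N)))
    (Eventually.of_forall fun N i => (hdiam _ _).trans (le_iSup (fun k => δ (k + N)) i.1))
    (Eventually.of_forall fun N p hp => by
      obtain ⟨n, hn, c, hc, hpc⟩ := (frequently_atTop.1 (hS p hp)) N
      obtain ⟨k, rfl⟩ := Nat.exists_eq_add_of_le' hn
      exact mem_iUnion.2 ⟨⟨k, c, hc⟩, hpc⟩)
  refine le_antisymm (hcover.trans ?_) bot_le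
  rw [← htail.liminf_eq]
  refine liminf_le_liminf (Eventually.of_forall fun N => ?_)
  rw [ENNReal.tsum_sigma']
  refine ENNReal.tsum_le_tsum fun k => ?_
  refine (ENNReal.tsum_le_tsum fun c : F (k + N) =>
    ENNReal.rpow_le_rpow (hdiam (c : X) (k + N)) s.2).trans_eq ?_
  rw [tsum_fintype, Finset.sum_const, Finset.card_univ, Fintype.card_coe, nsmul_eq_mul]
  rfl

/-- The prefixes of length `n` of sequences with digits in `J`, as pairs of integers. -/
def words (b : ℕ) (J : Finset (ℕ × ℕ)) : ℕ → Finset (ℕ × ℕ)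
  | 0 => {0}
  | n + 1 => Finset.image₂ (fun w e => (b * w.1 + e.1, b * w.2 + e.2)) (words b J n) J

lemma card_words_le (b : ℕ) (J : Finset (ℕ × ℕ)) (n : ℕ) : (words b J n).card ≤ J.card ^ n := by
  induction n with
  | zero => simp [words]
  | succ n ih =>
    rw [words, pow_succ]
    exact (Finset.card_image₂_le _ _ _).trans (Nat.mul_le_mul_right _ ih)

lemma pre_mem_words {b : ℕ} {J : Finset (ℕ × ℕ)} {d : ℕ → ℕ × ℕ} {n : ℕ}
    (hd : ∀ i, 1 ≤ i → i ≤ n → d i ∈ J) :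
    (pre b (fun i => (d i).1) n, pre b (fun i => (d i).2) n) ∈ words b J n := by
  induction n with
  | zero => simp [words, pre]
  | succ n ih =>
    exact Finset.mem_image₂_of_mem (ih fun i h1 h2 => hd i h1 (by omega))
      (hd (n + 1) (by omega) le_rfl)

variable {b : ℕ} {J : Finset (ℕ × ℕ)}

/-- Integers within distance `2` of a real number. -/
def nearInts (t : ℝ) : Finset ℤ := Finset.Icc ⌈t - 2⌉ ⌊t + 2⌋

lemma mem_nearInts {t : ℝ} {m : ℤ} (h : |(m : ℝ) - t| ≤ 2) : m ∈ nearInts t := by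
  rw [abs_le] at h
  exact Finset.mem_Icc.2 ⟨Int.ceil_le.2 (by linarith), Int.le_floor.2 (by linarith)⟩

lemma card_nearInts_le (t : ℝ) : (nearInts t).card ≤ 5 := by
  rw [nearInts, Int.card_Icc]
  have h1 := Int.floor_le (t + 2)
  have h2 := Int.le_ceil (t - 2)
  have h3 : ((⌊t + 2⌋ : ℤ) : ℝ) ≤ ((⌈t - 2⌉ + 4 : ℤ) : ℝ) := by push_cast; linarith
  have h4 : ⌊t + 2⌋ ≤ ⌈t - 2⌉ + 4 := by exact_mod_cast h3
  omega

/-- The centres of the balls covering the points whose `n`-th iterate lies in the target: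
`n` free digits, then `L` digits given by the centre, then `K` digits in the row `b - 1`. -/
def centres (b : ℕ) (J : Finset (ℕ × ℕ)) (z : ℝ) (n L K : ℕ) : Finset (ℝ × ℝ) :=
  (words b J n ×ˢ nearInts ((b : ℝ) ^ L * z) ×ˢ words b (J2 J (b - 1)) K).image fun i =>
    (((b : ℝ) ^ (L + K) * i.1.1 + (b : ℝ) ^ K * i.2.1 + i.2.2.1) / (b : ℝ) ^ (n + L + K),
      ((b : ℝ) ^ (L + K) * i.1.2 + (b : ℝ) ^ K * ((b : ℝ) ^ L - 1) + i.2.2.2) /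
        (b : ℝ) ^ (n + L + K))

lemma card_centres_le (b : ℕ) (J : Finset (ℕ × ℕ)) (z : ℝ) (n L K : ℕ) :
    (centres b J z n L K).card ≤ J.card ^ n * (5 * (J2 J (b - 1)).card ^ K) := by
  refine Finset.card_image_le.trans ?_
  rw [Finset.card_product, Finset.card_product]
  exact Nat.mul_le_mul (card_words_le _ _ _)
    (Nat.mul_le_mul (card_nearInts_le _) (card_words_le _ _ _))

lemma exists_centre (hb : 2 ≤ b) (hJ : ∀ e ∈ J, e.1 < b ∧ e.2 < b) (R : RepMap b J) {z : ℝ}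
    {n L K a c : ℕ} (hL : L ≤ a) (hK : L + K < c) {p : ℝ × ℝ} (hp : p ∈ carpet b J)
    (h1 : |((Tmap R)^[n] p).1 - z| ≤ (b : ℝ) ^ (-(a : ℤ)))
    (h2 : |((Tmap R)^[n] p).2 - 1| ≤ (b : ℝ) ^ (-(c : ℤ))) :
    ∃ q ∈ centres b J z n L K, dist p q ≤ ((b : ℝ) ^ (n + L + K))⁻¹ := by
  have hb1 : (1 : ℝ) < b := by exact_mod_cast hb
  obtain ⟨d, hd, rfl, hT⟩ := exists_digits_orbit hb hJ R n hp
  rw [hT] at h1 h2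
  have hx : ∀ i, 1 ≤ i → (d i).1 < b := fun i hi => (hJ _ (hd i hi)).1
  have hy : ∀ i, 1 ≤ i → (d i).2 < b := fun i hi => (hJ _ (hd i hi)).2
  have hxn : ∀ i, 1 ≤ i → (d (i + n)).1 < b := fun i hi => hx _ (by omega)
  have hyn : ∀ i, 1 ≤ i → (d (i + n)).2 < b := fun i hi => hy _ (by omega)
  have hrow : ∀ i, 1 ≤ i → i ≤ L + K → (d (i + n)).2 = b - 1 := by
    refine digit_eq_pred_of_lt (u := fun i => (d (i + n)).2) hb hyn ?_
    have hlt : (b : ℝ) ^ (L + K) * (b : ℝ) ^ (-(c : ℤ)) < 1 := by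
      rw [zpow_neg, zpow_natCast, ← div_eq_mul_inv, div_lt_one (by positivity)]
      exact pow_lt_pow_right₀ hb1 hK
    have hpos : (0 : ℝ) < (b : ℝ) ^ (L + K) := by positivity
    have h3 := (abs_le.1 h2).1
    simp only [point] at h3
    nlinarith
  have hnear : |((pre b (fun i => (d (i + n)).1) L : ℤ) : ℝ) - (b : ℝ) ^ L * z| ≤ 2 := by
    have hle : (b : ℝ) ^ L * (b : ℝ) ^ (-(a : ℤ)) ≤ 1 := by
      rw [zpow_neg, zpow_natCast, ← div_eq_mul_inv, div_le_one (by positivity)]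
      exact pow_le_pow_right₀ hb1.le hL
    have hpos : (0 : ℝ) < (b : ℝ) ^ L := by positivity
    have h3 := abs_le.1 h1
    have h4 := pre_le_pow_mul_val hb hxn L
    have h5 := pow_mul_val_le_pre_add_one hb hxn L
    simp only [point] at h3
    rw [Int.cast_natCast, abs_le]
    constructor <;> nlinarith
  have hw := pre_mem_words (b := b) (J := J) (d := d) (n := n) fun i hi _ => hd i hi
  have hv := pre_mem_words (b := b) (J := J2 J (b - 1)) (d := fun i => d (i + L + n)) (n := K)
    fun i hi hiK => Finset.mem_filter.2 ⟨hd _ (by omega), hrow _ (by omega) (by omega)⟩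
  refine ⟨_, Finset.mem_image_of_mem _ (Finset.mk_mem_product hw
    (Finset.mk_mem_product (mem_nearInts hnear) hv)), ?_⟩
  have hyL : ((pre b (fun i => (d (i + n)).2) L : ℕ) : ℝ) = (b : ℝ) ^ L - 1 := by
    rw [pre_congr (v := fun _ => b - 1) fun i hi hiL => hrow i hi (by omega)]
    have := pre_const_pred hb L
    rw [eq_sub_iff_add_eq]
    exact_mod_cast this
  have hsplit : ∀ f : ℕ × ℕ → ℕ, (pre b (fun i => f (d i)) (n + L + K) : ℝ) =
      (b : ℝ) ^ (L + K) * pre b (fun i => f (d i)) n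
        + (b : ℝ) ^ K * pre b (fun i => f (d (i + n))) L
        + pre b (fun i => f (d (i + L + n))) K := by
    intro f
    rw [pre_add, pre_add, show (fun i => f (d (i + (n + L)))) = fun i => f (d (i + L + n)) by
      funext i; congr 2; omega]
    push_cast
    ring
  have hpos : (0 : ℝ) < (b : ℝ) ^ (n + L + K) := by positivity
  have hclose : ∀ u : ℕ → ℕ, (∀ i, 1 ≤ i → u i < b) →
      |val b u - pre b u (n + L + K) / (b : ℝ) ^ (n + L + K)| ≤ ((b : ℝ) ^ (n + L + K))⁻¹ := by
    intro u hu
    have h3 := pre_le_pow_mul_val hb hu (n + L + K)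
    have h4 := pow_mul_val_le_pre_add_one hb hu (n + L + K)
    rw [show val b u - pre b u (n + L + K) / (b : ℝ) ^ (n + L + K) =
      ((b : ℝ) ^ (n + L + K) * val b u - pre b u (n + L + K)) * ((b : ℝ) ^ (n + L + K))⁻¹ by
        field_simp, abs_mul, abs_of_pos (inv_pos.2 hpos)]
    refine mul_le_of_le_one_left (inv_pos.2 hpos).le (abs_le.2 ⟨by linarith, by linarith⟩)
  have hX := hclose _ hx
  have hY := hclose _ hy
  rw [hsplit Prod.fst] at hX
  rw [hsplit Prod.snd, hyL] at hY
  rw [Prod.dist_eq, Real.dist_eq, Real.dist_eq]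
  exact max_le (by simpa only [point, Int.cast_natCast] using hX) hY

end UpperBound

section UpperDimension

variable {b : ℕ} {J : Finset (ℕ × ℕ)}

lemma summable_card_mul_rpow {k B b : ℕ} (hk : 1 ≤ k) (hB : 1 ≤ B) (hb : 2 ≤ b) {lam j : ℕ → ℕ}
    (hpos : ∀ n, 1 ≤ lam n) (hj : ∀ n, lam n ≤ j n) {l θ s : ℝ} (hθ : 0 ≤ θ)
    (hl : Tendsto (fun n : ℕ => (lam n : ℝ) / n) atTop (𝓝 l))
    (hjθ : Tendsto (fun n : ℕ => (j n : ℝ) / n) atTop (𝓝 θ))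
    (hs : (Real.log k / Real.log b + (θ - l) * (Real.log B / Real.log b)) / (1 + θ) < s) :
    Summable fun n => (k : ℝ) ^ n * (5 * (B : ℝ) ^ (j n - lam n)) *
      (((b : ℝ) ^ (n + (lam n - 1) + (j n - lam n)))⁻¹) ^ s := by
  have hb1 : (1 : ℝ) < b := by exact_mod_cast hb
  have hb0 : (0 : ℝ) < b := by linarith
  have hk0 : (0 : ℝ) < k := by exact_mod_cast hk
  have hB0 : (0 : ℝ) < B := by exact_mod_cast hB
  have hlogb : 0 < Real.log b := Real.log_pos hb1
  let E : ℕ → ℝ := fun n => n * Real.log k + ((j n : ℝ) - lam n) * Real.log B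
    - s * ((n + j n - 1) * Real.log b)
  have hterm : ∀ n, (k : ℝ) ^ n * (5 * (B : ℝ) ^ (j n - lam n)) *
      (((b : ℝ) ^ (n + (lam n - 1) + (j n - lam n)))⁻¹) ^ s = 5 * Real.exp (E n) := by
    intro n
    have h1 : (k : ℝ) ^ n = Real.exp (n * Real.log k) := by
      rw [← Real.rpow_natCast, Real.rpow_def_of_pos hk0, mul_comm]
    have h2 : (B : ℝ) ^ (j n - lam n) = Real.exp (((j n : ℝ) - lam n) * Real.log B) := by
      rw [← Real.rpow_natCast, Real.rpow_def_of_pos hB0, mul_comm, Nat.cast_sub (hj n)]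
    have h3 : (((b : ℝ) ^ (n + (lam n - 1) + (j n - lam n)))⁻¹) ^ s =
        Real.exp (-(s * ((n + j n - 1) * Real.log b))) := by
      have := hpos n
      have := hj n
      have hcast : ((n + (lam n - 1) + (j n - lam n) : ℕ) : ℝ) = n + j n - 1 := by
        rw [eq_sub_iff_add_eq]
        exact_mod_cast (by omega : n + (lam n - 1) + (j n - lam n) + 1 = n + j n)
      rw [← Real.rpow_natCast, hcast, Real.rpow_def_of_pos hb0, ← Real.exp_neg, ← Real.exp_mul]
      ring_nf
    simp only [E]
    rw [h1, h2, h3, sub_eq_add_neg _ (s * _), Real.exp_add, Real.exp_add]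
    ring
  simp_rw [hterm]
  refine Summable.mul_left _ ?_
  set c : ℝ := Real.log k + (θ - l) * Real.log B - s * ((1 + θ) * Real.log b) with hc
  have hcneg : c < 0 := by
    rw [div_lt_iff₀ (by linarith)] at hs
    have h := mul_lt_mul_of_pos_right hs hlogb
    have e : (Real.log k / Real.log b + (θ - l) * (Real.log B / Real.log b)) * Real.log b =
      Real.log k + (θ - l) * Real.log B := by field_simp
    rw [e] at h
    linarith
  have hlim : Tendsto (fun n : ℕ => E n / n) atTop (𝓝 c) := by
    have h1 : Tendsto (fun n : ℕ => (n : ℝ) / n) atTop (𝓝 1) :=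
      tendsto_const_nhds.congr' ((eventually_ge_atTop 1).mono fun n hn =>
        (div_self (by positivity)).symm)
    have h2 := ((h1.mul_const (Real.log k)).add ((hjθ.sub hl).mul_const (Real.log B))).sub
      ((((h1.add hjθ).sub (tendsto_const_div_atTop_nhds_zero_nat (1 : ℝ))).mul_const
        (Real.log b)).const_mul s)
    rw [one_mul, sub_zero] at h2
    refine h2.congr fun n => ?_
    simp only [E]
    ring
  have hev : ∀ᶠ n : ℕ in atTop, E n ≤ n * (c / 2) := by
    filter_upwards [hlim.eventually_lt_const (show c < c / 2 by linarith),
      eventually_gt_atTop 0] with n hn hn0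
    have : (0 : ℝ) < n := by exact_mod_cast hn0
    rw [div_lt_iff₀ this] at hn
    linarith
  refine Summable.of_norm_bounded_eventually_nat
    (Real.summable_exp_nat_mul_iff.2 (show c / 2 < 0 by linarith)) ?_
  filter_upwards [hev] with n hn
  rw [Real.norm_of_nonneg (Real.exp_pos _).le]
  exact Real.exp_le_exp.2 hn

lemma dimH_targetSet_le (hb : 2 ≤ b) (hJ : ∀ e ∈ J, e.1 < b ∧ e.2 < b) (hJ0 : 1 ≤ J.card)
    (hB : 1 ≤ (J2 J (b - 1)).card) (R : RepMap b J) {lam xi j : ℕ → ℕ}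
    (hpos : ∀ n, 1 ≤ lam n) (hj : ∀ n, lam n ≤ j n) (hjx : ∀ n, j n ≤ xi n) {l θ : ℝ}
    (hθ : 0 ≤ θ) (hl : Tendsto (fun n : ℕ => (lam n : ℝ) / n) atTop (𝓝 l))
    (hjθ : Tendsto (fun n : ℕ => (j n : ℝ) / n) atTop (𝓝 θ)) (z : ℝ) :
    dimH (targetSet R lam xi z 1) ≤ ENNReal.ofReal ((Real.log J.card / Real.log b +
      (θ - l) * (Real.log (J2 J (b - 1)).card / Real.log b)) / (1 + θ)) := by
  have hb1 : (1 : ℝ) < b := by exact_mod_cast hb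
  refine le_of_forall_gt_imp_ge_of_dense fun a ha => ?_
  obtain ⟨s, hs, hsa⟩ := ENNReal.lt_iff_exists_nnreal_btwn.1 ha
  refine le_trans ?_ hsa.le
  have hs' := (Real.le_coe_toNNReal _).trans_lt (NNReal.coe_lt_coe.2 (ENNReal.coe_lt_coe.1 hs))
  refine dimH_le_of_frequently_dist_le _
    (fun n => centres b J z n (lam n - 1) (j n - lam n))
    (fun n => ((b : ℝ) ^ (n + (lam n - 1) + (j n - lam n)))⁻¹) (fun n => by positivity) ?_ s ?_ ?_
  · refine squeeze_zero (fun n => by positivity) (fun n => ?_)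
      (tendsto_pow_atTop_nhds_zero_of_lt_one (inv_nonneg.2 (by positivity))
        (inv_lt_one_of_one_lt₀ hb1))
    rw [inv_pow]
    gcongr
    · exact hb1.le
    · omega
  · rintro p ⟨hp, hfreq⟩
    refine hfreq.mono fun n hn => ?_
    have := hpos n
    have := hj n
    have := hjx n
    refine exists_centre hb hJ R (a := lam n) (c := xi n) (by omega) (by omega) hp ?_ ?_
    · exact abs_le.2 ⟨by linarith [hn.1.1], by linarith [hn.1.2]⟩
    · exact abs_le.2 ⟨by linarith [hn.2.1], by linarith [hn.2.2]⟩
  · refine Summable.of_nonneg_of_le (fun n => by positivity) (fun n => ?_)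
      (summable_card_mul_rpow hJ0 hB hb hpos hj hθ hl hjθ hs')
    gcongr
    exact_mod_cast card_centres_le b J z n _ _

end UpperDimension

section MassDistribution

variable {b : ℕ} {D : ℕ → Finset (ℕ × ℕ)}

/-- The product of the uniform measures on the digit sets `D i`. -/
def digitMeasure (D : ℕ → Finset (ℕ × ℕ)) (hD : ∀ i, (D i).Nonempty) : Measure (ℕ → ℕ × ℕ) :=
  Measure.infinitePi fun i => (PMF.uniformOfFinset (D i) (hD i)).toMeasure

/-- The point with digit sequence `d`, all digits being truncated to `{0, …, b - 1}`. -/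
def clampPoint (b : ℕ) (d : ℕ → ℕ × ℕ) : ℝ × ℝ :=
  point b fun i => (min (d i).1 (b - 1), min (d i).2 (b - 1))

lemma clampPoint_eq {d : ℕ → ℕ × ℕ} (hd : ∀ i, (d i).1 < b ∧ (d i).2 < b) :
    clampPoint b d = point b d := by
  have : (fun i => (min (d i).1 (b - 1), min (d i).2 (b - 1))) = d := by
    funext i
    have := hd i
    exact Prod.ext (min_eq_left (by omega)) (min_eq_left (by omega))
  rw [clampPoint, this]

lemma continuous_clampPoint (hb : 2 ≤ b) : Continuous (clampPoint b) := by
  have hs := summable_digits (u := fun _ => b - 1) hb fun _ _ => by omega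
  have key : ∀ f : ℕ × ℕ → ℕ, Continuous fun d : ℕ → ℕ × ℕ =>
      val b fun i => min (f (d i)) (b - 1) := by
    intro f
    refine continuous_tsum (fun i => ?_) hs fun i d => ?_
    · have h : Continuous fun e : ℕ × ℕ => ((min (f e) (b - 1) : ℕ) : ℝ) / (b : ℝ) ^ (i + 1) :=
        continuous_of_discreteTopology
      exact h.comp (continuous_apply (i + 1))
    · rw [Real.norm_of_nonneg (by positivity)]
      gcongr
      exact min_le_right _ _
  exact (key Prod.fst).prodMk (key Prod.snd)

variable (hD : ∀ i, (D i).Nonempty)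

instance : IsProbabilityMeasure (digitMeasure D hD) := by
  unfold digitMeasure; infer_instance

lemma ae_mem_digits : ∀ᵐ d ∂digitMeasure D hD, ∀ i, d i ∈ D i := by
  rw [ae_all_iff]
  intro i
  refine (measurePreserving_eval_infinitePi
    (fun i => (PMF.uniformOfFinset (D i) (hD i)).toMeasure) i).quasiMeasurePreserving.ae
    (p := fun e => e ∈ D i) ?_
  have hmeas : MeasurableSet (D i : Set (ℕ × ℕ)) := (D i).measurableSet
  have h := (PMF.toMeasure_apply_eq_one_iff (PMF.uniformOfFinset (D i) (hD i)) hmeas).2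
    (PMF.support_uniformOfFinset _).subset
  exact (mem_ae_iff_prob_eq_one hmeas).2 h

lemma digitMeasure_cylinder_le (e : ℕ → ℕ × ℕ) (N : ℕ) :
    digitMeasure D hD {d | ∀ i, 1 ≤ i → i ≤ N → d i = e i} ≤
      ∏ i ∈ Finset.Icc 1 N, ((D i).card : ℝ≥0∞)⁻¹ := by
  have hset : {d : ℕ → ℕ × ℕ | ∀ i, 1 ≤ i → i ≤ N → d i = e i} =
      (↑(Finset.Icc 1 N) : Set ℕ).pi fun i => {e i} := by
    ext d
    simp [Set.mem_pi]
  rw [hset, digitMeasure, Measure.infinitePi_pi _ fun i _ => measurableSet_singleton _]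
  refine Finset.prod_le_prod' fun i _ => ?_
  rw [PMF.toMeasure_apply_singleton _ _ (measurableSet_singleton _), PMF.uniformOfFinset_apply]
  split_ifs
  · exact le_rfl
  · exact bot_le

/-- A ball of radius `b⁻ᴺ` meets boundedly many cylinders of length `N`. -/
lemma digitMeasure_closedBall_le (hb : 2 ≤ b) (hDb : ∀ i, ∀ e ∈ D i, e.1 < b ∧ e.2 < b) {s : ℝ}
    (hM : ∀ N : ℕ, (b : ℝ) ^ (s * N) ≤ ∏ i ∈ Finset.Icc 1 N, ((D i).card : ℝ))
    (p : ℝ × ℝ) (N : ℕ) :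
    digitMeasure D hD (clampPoint b ⁻¹' Metric.closedBall p ((b : ℝ) ^ N)⁻¹) ≤
      25 * ENNReal.ofReal ((b : ℝ) ^ (s * N))⁻¹ := by
  have hb0 : (0 : ℝ) < b := by positivity
  let K : Finset (ℤ × ℤ) := nearInts ((b : ℝ) ^ N * p.1) ×ˢ nearInts ((b : ℝ) ^ N * p.2)
  let cyl : ℤ × ℤ → Set (ℕ → ℕ × ℕ) := fun m => {d | (∀ i, d i ∈ D i) ∧
    ((pre b (fun i => (d i).1) N : ℕ) : ℤ) = m.1 ∧ ((pre b (fun i => (d i).2) N : ℕ) : ℤ) = m.2}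
  have hcyl : ∀ m, digitMeasure D hD (cyl m) ≤ ENNReal.ofReal ((b : ℝ) ^ (s * N))⁻¹ := by
    intro m
    rcases (cyl m).eq_empty_or_nonempty with h | ⟨e, he, he1, he2⟩
    · rw [h, measure_empty]; exact bot_le
    · refine (measure_mono ?_).trans ((digitMeasure_cylinder_le hD e N).trans ?_)
      · rintro d ⟨hd, hd1, hd2⟩ i hi hiN
        refine Prod.ext ?_ ?_
        · exact eq_of_pre_eq (u := fun i => (d i).1) (v := fun i => (e i).1)
            (fun i _ => (hDb i _ (hd i)).1) (fun i _ => (hDb i _ (he i)).1)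
            (by exact_mod_cast hd1.trans he1.symm) i hi hiN
        · exact eq_of_pre_eq (u := fun i => (d i).2) (v := fun i => (e i).2)
            (fun i _ => (hDb i _ (hd i)).2) (fun i _ => (hDb i _ (he i)).2)
            (by exact_mod_cast hd2.trans he2.symm) i hi hiN
      · have hprod : ∏ i ∈ Finset.Icc 1 N, ((D i).card : ℝ≥0∞)⁻¹ =
            ENNReal.ofReal (∏ i ∈ Finset.Icc 1 N, ((D i).card : ℝ))⁻¹ := by
          rw [← Finset.prod_inv_distrib, ENNReal.ofReal_prod_of_nonneg fun i _ => by positivity]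
          refine Finset.prod_congr rfl fun i _ => ?_
          rw [ENNReal.ofReal_inv_of_pos (by exact_mod_cast (hD i).card_pos), ENNReal.ofReal_natCast]
        rw [hprod]
        exact ENNReal.ofReal_le_ofReal
          (inv_anti₀ (Real.rpow_pos_of_pos hb0 _) (hM N))
  have hsub : clampPoint b ⁻¹' Metric.closedBall p ((b : ℝ) ^ N)⁻¹ ≤ᵐ[digitMeasure D hD]
      ⋃ m ∈ K, cyl m := by
    filter_upwards [ae_mem_digits hD] with d hd hdp
    have hdb := fun i => hDb i _ (hd i)
    have hball : dist (clampPoint b d) p ≤ ((b : ℝ) ^ N)⁻¹ := hdp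
    rw [clampPoint_eq hdb, Prod.dist_eq, max_le_iff, Real.dist_eq, Real.dist_eq] at hball
    have hpos : (0 : ℝ) < (b : ℝ) ^ N := by positivity
    have hnear : ∀ (u : ℕ → ℕ) (t : ℝ), (∀ i, 1 ≤ i → u i < b) →
        |val b u - t| ≤ ((b : ℝ) ^ N)⁻¹ → ((pre b u N : ℕ) : ℤ) ∈ nearInts ((b : ℝ) ^ N * t) := by
      intro u t hu ht
      have h1 := pre_le_pow_mul_val hb hu N
      have h2 := pow_mul_val_le_pre_add_one hb hu N
      have h3 : |(b : ℝ) ^ N * val b u - (b : ℝ) ^ N * t| ≤ 1 := by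
        rw [← mul_sub, abs_mul, abs_of_pos hpos]
        calc (b : ℝ) ^ N * |val b u - t| ≤ (b : ℝ) ^ N * ((b : ℝ) ^ N)⁻¹ := by gcongr
          _ = 1 := mul_inv_cancel₀ hpos.ne'
      rw [abs_le] at h3
      refine mem_nearInts ?_
      rw [Int.cast_natCast, abs_le]
      constructor <;> linarith
    exact mem_iUnion₂.2 ⟨(_, _), Finset.mk_mem_product
      (hnear _ _ (fun i _ => (hdb i).1) hball.1) (hnear _ _ (fun i _ => (hdb i).2) hball.2),
      hd, rfl, rfl⟩
  refine (measure_mono_ae hsub).trans ((measure_biUnion_finset_le K cyl).trans ?_)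
  refine (Finset.sum_le_card_nsmul K _ _ fun m _ => hcyl m).trans ?_
  rw [nsmul_eq_mul]
  gcongr
  have : K.card ≤ 25 := by
    rw [Finset.card_product]
    exact Nat.mul_le_mul (card_nearInts_le _) (card_nearInts_le _)
  exact_mod_cast this

/-- Mass distribution principle for sets defined by independent digit restrictions. -/
lemma le_dimH_of_digits (hD : ∀ i, (D i).Nonempty) (hb : 2 ≤ b)
    (hDb : ∀ i, ∀ e ∈ D i, e.1 < b ∧ e.2 < b) {s : ℝ≥0}
    (hs : 0 < s)
    (hM : ∀ N : ℕ, (b : ℝ) ^ (s * N : ℝ) ≤ ∏ i ∈ Finset.Icc 1 N, ((D i).card : ℝ))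
    {S : Set (ℝ × ℝ)} (hS : ∀ d : ℕ → ℕ × ℕ, (∀ i, d i ∈ D i) → point b d ∈ S) :
    (s : ℝ≥0∞) ≤ dimH S := by
  have hb1 : (1 : ℝ) < b := by exact_mod_cast hb
  have hb0 : (0 : ℝ) < b := by positivity
  have hs0 : (0 : ℝ) < s := hs
  have hmeas : Measurable (clampPoint b) := (continuous_clampPoint hb).measurable
  set ν := (digitMeasure D hD).map (clampPoint b) with hν
  have hball : ∀ (p : ℝ × ℝ) (N : ℕ), ν (Metric.closedBall p ((b : ℝ) ^ N)⁻¹) ≤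
      25 * ENNReal.ofReal ((b : ℝ) ^ (s * N : ℝ))⁻¹ := by
    intro p N
    rw [hν, Measure.map_apply hmeas Metric.isClosed_closedBall.measurableSet]
    exact digitMeasure_closedBall_le hD hb hDb hM p N
  have hνS : 1 ≤ ν S := by
    refine le_trans ?_ (Measure.le_map_apply hmeas.aemeasurable S)
    rw [← measure_univ (μ := digitMeasure D hD)]
    refine measure_mono_ae ?_
    filter_upwards [ae_mem_digits hD] with d hd _
    change clampPoint b d ∈ S
    rw [clampPoint_eq fun i => hDb i _ (hd i)]
    exact hS d hd
  let C : ℝ≥0∞ := 25 * ENNReal.ofReal ((b : ℝ) ^ (s : ℝ))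
  have hC0 : C ≠ 0 := mul_ne_zero (by norm_num)
    (ENNReal.ofReal_pos.2 (Real.rpow_pos_of_pos hb0 _)).ne'
  have hCtop : C ≠ ⊤ := ENNReal.mul_ne_top (by norm_num) ENNReal.ofReal_ne_top
  have hsmall : ∀ A : Set (ℝ × ℝ), Metric.ediam A ≤ 1 → ν A ≤ C * Metric.ediam A ^ (s : ℝ) := by
    intro A hA
    rcases A.eq_empty_or_nonempty with rfl | ⟨p, hp⟩
    · rw [measure_empty]; exact bot_le
    have htop : Metric.ediam A ≠ ⊤ := ne_top_of_le_ne_top ENNReal.one_ne_top hA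
    have hdist : ∀ q ∈ A, dist q p ≤ (Metric.ediam A).toReal := by
      intro q hq
      rw [dist_edist]
      exact ENNReal.toReal_mono htop (Metric.edist_le_ediam_of_mem hq hp)
    have hsub : ∀ N : ℕ, (Metric.ediam A).toReal ≤ ((b : ℝ) ^ N)⁻¹ →
        ν A ≤ 25 * ENNReal.ofReal ((b : ℝ) ^ (s * N : ℝ))⁻¹ := fun N hN =>
      (measure_mono fun q hq => (hdist q hq).trans hN).trans (hball p N)
    rcases eq_or_ne (Metric.ediam A) 0 with h0 | h0
    · have hlim : Tendsto (fun N : ℕ => 25 * ENNReal.ofReal ((b : ℝ) ^ (s * N : ℝ))⁻¹) atTop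
          (𝓝 0) := by
        have h1 : Tendsto (fun N : ℕ => ((b : ℝ) ^ (s * N : ℝ))⁻¹) atTop (𝓝 0) := by
          have h2 := tendsto_pow_atTop_nhds_zero_of_lt_one
            (inv_nonneg.2 (Real.rpow_nonneg hb0.le (s : ℝ)))
            (inv_lt_one_of_one_lt₀ (Real.one_lt_rpow hb1 hs0))
          refine h2.congr fun N => ?_
          rw [inv_pow, Real.rpow_mul hb0.le, Real.rpow_natCast]
        have h3 := ENNReal.Tendsto.const_mul (a := 25) (ENNReal.tendsto_ofReal h1)
          (Or.inr (by norm_num))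
        rwa [ENNReal.ofReal_zero, mul_zero] at h3
      refine (ge_of_tendsto' hlim fun N => hsub N ?_).trans bot_le
      rw [h0, ENNReal.toReal_zero]
      positivity
    · have hpos : 0 < (Metric.ediam A).toReal := ENNReal.toReal_pos h0 htop
      have hle1 : (Metric.ediam A).toReal ≤ 1 := ENNReal.toReal_le_of_le_ofReal zero_le_one
        (by rwa [ENNReal.ofReal_one])
      obtain ⟨N, hN1, hN2⟩ := exists_nat_pow_near_of_lt_one hpos hle1 (inv_pos.2 hb0)
        (inv_lt_one_of_one_lt₀ hb1)
      rw [inv_pow] at hN2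
      refine (hsub N hN2).trans ?_
      rw [mul_assoc]
      gcongr
      rw [← ENNReal.ofReal_toReal htop, ENNReal.ofReal_rpow_of_pos hpos,
        ← ENNReal.ofReal_mul (Real.rpow_nonneg hb0.le _)]
      refine ENNReal.ofReal_le_ofReal ?_
      calc ((b : ℝ) ^ (s * N : ℝ))⁻¹ = (b : ℝ) ^ (s : ℝ) * ((b : ℝ)⁻¹ ^ (N + 1)) ^ (s : ℝ) := by
            rw [← Real.rpow_natCast, ← Real.rpow_mul (inv_nonneg.2 hb0.le),
              Real.inv_rpow hb0.le, ← Real.rpow_neg hb0.le, ← Real.rpow_neg hb0.le,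
              ← Real.rpow_add hb0]
            congr 1
            push_cast
            ring
        _ ≤ _ := by gcongr
  have hH : C⁻¹ • ν ≤ μH[s] := by
    refine Measure.le_hausdorffMeasure _ _ 1 one_pos fun A hA => ?_
    rw [Measure.smul_apply, smul_eq_mul, mul_comm, ← div_eq_mul_inv]
    exact ENNReal.div_le_of_le_mul' (hsmall A hA)
  refine le_dimH_of_hausdorffMeasure_ne_zero (ne_of_gt (lt_of_lt_of_le ?_ (hH S)))
  rw [Measure.smul_apply, smul_eq_mul]
  exact ENNReal.mul_pos (ENNReal.inv_ne_zero.2 hCtop) (one_pos.trans_le hνS).ne'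

end MassDistribution

section BlockConstruction

lemma prod_mul_pow_le_prod {f : ℕ → ℝ} (hf : ∀ i, 0 ≤ f i) {m : ℝ} (hm : 0 ≤ m) {a N : ℕ}
    (haN : a ≤ N) (h : ∀ i, a < i → i ≤ N → m ≤ f i) :
    (∏ i ∈ Finset.Icc 1 a, f i) * m ^ (N - a) ≤ ∏ i ∈ Finset.Icc 1 N, f i := by
  induction N, haN using Nat.le_induction with
  | base => simp
  | succ N haN ih =>
    rw [Finset.prod_Icc_succ_top (by omega), Nat.succ_sub haN, pow_succ, ← mul_assoc]
    exact mul_le_mul (ih fun i h1 h2 => h i h1 (by omega)) (h _ (by omega) le_rfl) hm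
      (Finset.prod_nonneg fun i _ => hf i)

/-- Geometric interpolation: a bound by powers of `t` at both ends of a stretch of constant
growth rate holds on the whole stretch. -/
lemma pow_le_mul_pow_of_ends {t B P : ℝ} (ht : 0 < t) (hB : 0 < B) (hP : 0 ≤ P) {m r R : ℕ}
    (hrR : r ≤ R) (h0 : t ^ m ≤ P) (h1 : t ^ (m + R) ≤ P * B ^ R) : t ^ (m + r) ≤ P * B ^ r := by
  rcases le_total t B with htB | hBt
  · rw [pow_add]
    exact mul_le_mul h0 (pow_le_pow_left₀ ht.le htB r) (by positivity) hP
  · obtain ⟨q, rfl⟩ := Nat.exists_eq_add_of_le hrR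
    refine le_of_mul_le_mul_right ?_ (pow_pos hB q)
    calc t ^ (m + r) * B ^ q ≤ t ^ (m + r) * t ^ q := by gcongr
      _ = t ^ (m + (r + q)) := by rw [← pow_add, add_assoc]
      _ ≤ P * B ^ (r + q) := h1
      _ = P * B ^ r * B ^ q := by rw [pow_add, mul_assoc]

lemma pow_le_prod_of_blocks {f : ℕ → ℝ} (hf : ∀ i, 1 ≤ f i) {t K B : ℝ} (ht : 1 ≤ t)
    (htK : t ≤ K) (hB : 1 ≤ B) {E n p q : ℕ → ℕ} (hE0 : E 0 = 0)
    (hE : ∀ k, E (k + 1) = n k + q k + 1) (hn : ∀ k, E k ≤ n k) (hpq : ∀ k, p k ≤ q k)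
    (hfree : ∀ k i, E k < i → i ≤ n k → K ≤ f i)
    (hrow : ∀ k i, n k + p k < i → i ≤ n k + q k → B ≤ f i)
    (hp : ∀ k, t ^ (n k + p k + 1) ≤ K ^ (n k - E k))
    (hq : ∀ k, t ^ (n k + q k + 1) ≤ K ^ (n k - E k) * B ^ (q k - p k)) (N : ℕ) :
    t ^ N ≤ ∏ i ∈ Finset.Icc 1 N, f i := by
  have hf0 : ∀ i, 0 ≤ f i := fun i => zero_le_one.trans (hf i)
  have hprod1 : ∀ N, 1 ≤ ∏ i ∈ Finset.Icc 1 N, f i := fun N =>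
    Finset.prod_const_one.symm.le.trans
      (Finset.prod_le_prod (fun _ _ => zero_le_one) fun i _ => hf i)
  have hmono : ∀ {a N : ℕ}, a ≤ N → ∏ i ∈ Finset.Icc 1 a, f i ≤ ∏ i ∈ Finset.Icc 1 N, f i := by
    intro a N h
    simpa using prod_mul_pow_le_prod hf0 zero_le_one h fun i _ _ => hf i
  have hK0 : 0 ≤ K := by linarith
  have hB0 : 0 ≤ B := by linarith
  have main : ∀ k, ∀ N ≤ E k, t ^ N ≤ ∏ i ∈ Finset.Icc 1 N, f i := by
    intro k
    induction k with
    | zero =>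
      intro N hN
      rw [show N = 0 by omega]
      simp
    | succ k ih =>
      intro N hN
      rcases le_total N (E k) with h1 | h1
      · exact ih N h1
      have hfull : K ^ (n k - E k) ≤ ∏ i ∈ Finset.Icc 1 (n k), f i :=
        (le_mul_of_one_le_left (by positivity) (hprod1 _)).trans
          (prod_mul_pow_le_prod hf0 hK0 (hn k) fun i => hfree k i)
      have hrowN : ∀ r, p k ≤ r → r ≤ q k →
          t ^ (n k + r + 1) ≤ ∏ i ∈ Finset.Icc 1 (n k + r), f i := by
        intro r hr1 hr2
        have hpr := prod_mul_pow_le_prod hf0 hB0 (show n k + p k ≤ n k + r by omega)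
          fun i hi1 hi2 => hrow k i hi1 (by omega)
        rw [show n k + r - (n k + p k) = r - p k by omega] at hpr
        refine le_trans ?_ hpr
        have hpq' := hpq k
        have hint := pow_le_mul_pow_of_ends (t := t) (B := B) (m := n k + p k + 1) (r := r - p k)
          (R := q k - p k) (by linarith) (by linarith) (pow_nonneg hK0 _) (by omega) (hp k)
          (by rw [show n k + p k + 1 + (q k - p k) = n k + q k + 1 by omega]; exact hq k)
        rw [show n k + p k + 1 + (r - p k) = n k + r + 1 by omega] at hint
        refine hint.trans ?_
        gcongr
        exact hfull.trans (hmono (by omega))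
      rcases le_total N (n k) with h2 | h2
      · have h3 := prod_mul_pow_le_prod hf0 hK0 h1 fun i hi1 hi2 => hfree k i hi1 (by omega)
        refine le_trans ?_ h3
        calc t ^ N = t ^ E k * t ^ (N - E k) := by rw [← pow_add]; congr 1; omega
          _ ≤ _ := mul_le_mul (ih _ le_rfl) (pow_le_pow_left₀ (by linarith) htK _)
            (by positivity) (zero_le_one.trans (hprod1 _))
      rcases le_total N (n k + p k) with h3 | h3
      · calc t ^ N ≤ t ^ (n k + p k + 1) := pow_le_pow_right₀ ht (by omega)
          _ ≤ _ := (hp k).trans (hfull.trans (hmono h2))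
      rcases le_total N (n k + q k) with h4 | h4
      · have h5 := hrowN (N - n k) (by omega) (by omega)
        rw [show n k + (N - n k) = N by omega] at h5
        exact (pow_le_pow_right₀ ht (by omega)).trans h5
      · have h5 := hrowN (q k) (hpq k) le_rfl
        rw [hE] at hN
        exact (pow_le_pow_right₀ ht hN).trans (h5.trans (hmono h4))
  refine main N N ?_
  have hEmono : StrictMono E := strictMono_nat_of_lt_succ fun k => by
    have := hE k
    have := hn k
    omega
  exact hEmono.le_apply

lemma eventually_pow_le {k B b : ℕ} (hk : 1 ≤ k) (hB : 1 ≤ B) (hb : 2 ≤ b) {lam j : ℕ → ℕ}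
    (hj : ∀ n, lam n ≤ j n) {l θ s : ℝ} (hθ : 0 ≤ θ)
    (hl : Tendsto (fun n : ℕ => (lam n : ℝ) / n) atTop (𝓝 l))
    (hjθ : Tendsto (fun n : ℕ => (j n : ℝ) / n) atTop (𝓝 θ))
    (hs : s < (Real.log k / Real.log b + (θ - l) * (Real.log B / Real.log b)) / (1 + θ)) (a : ℕ) :
    ∀ᶠ n in atTop, ((b : ℝ) ^ s) ^ (n + j n + 1) ≤ (k : ℝ) ^ (n - a) * (B : ℝ) ^ (j n - lam n) := by
  have hb1 : (1 : ℝ) < b := by exact_mod_cast hb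
  have hb0 : (0 : ℝ) < b := by linarith
  have hk0 : (0 : ℝ) < k := by exact_mod_cast hk
  have hB0 : (0 : ℝ) < B := by exact_mod_cast hB
  have hlogb : 0 < Real.log b := Real.log_pos hb1
  let E : ℕ → ℝ := fun n => (n - a) * Real.log k + ((j n : ℝ) - lam n) * Real.log B
    - s * ((n + j n + 1) * Real.log b)
  set c : ℝ := Real.log k + (θ - l) * Real.log B - s * ((1 + θ) * Real.log b) with hc
  have hcpos : 0 < c := by
    rw [lt_div_iff₀ (by linarith)] at hs
    have h := mul_lt_mul_of_pos_right hs hlogb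
    have e : (Real.log k / Real.log b + (θ - l) * (Real.log B / Real.log b)) * Real.log b =
      Real.log k + (θ - l) * Real.log B := by field_simp
    rw [e] at h
    linarith
  have hlim : Tendsto (fun n : ℕ => E n / n) atTop (𝓝 c) := by
    have h1 : Tendsto (fun n : ℕ => (n : ℝ) / n) atTop (𝓝 1) :=
      tendsto_const_nhds.congr' ((eventually_ge_atTop 1).mono fun n hn =>
        (div_self (by positivity)).symm)
    have h2 := (((h1.sub (tendsto_const_div_atTop_nhds_zero_nat (a : ℝ))).mul_const
      (Real.log k)).add ((hjθ.sub hl).mul_const (Real.log B))).sub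
      ((((h1.add hjθ).add (tendsto_const_div_atTop_nhds_zero_nat (1 : ℝ))).mul_const
        (Real.log b)).const_mul s)
    rw [sub_zero, one_mul, add_zero] at h2
    refine h2.congr fun n => ?_
    simp only [E]
    ring
  filter_upwards [hlim.eventually_const_lt hcpos, eventually_gt_atTop 0,
    eventually_ge_atTop a] with n hn hn0 hna
  have hn0' : (0 : ℝ) < n := by exact_mod_cast hn0
  have hE : 0 < E n := by
    rw [lt_div_iff₀ hn0', zero_mul] at hn
    exact hn
  rw [← Real.log_le_log_iff (by positivity) (by positivity), Real.log_pow, Real.log_rpow hb0,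
    Real.log_mul (by positivity) (by positivity), Real.log_pow, Real.log_pow, Nat.cast_sub hna,
    Nat.cast_sub (hj n)]
  simp only [E] at hE
  push_cast
  linarith

lemma exists_recurrent_enumeration {α : Type*} (J : Finset α) (hJ : J.Nonempty) :
    ∃ c : ℕ → α, (∀ k, c k ∈ J) ∧ ∀ e ∈ J, ∃ᶠ k in atTop, c k = e := by
  have : Nonempty J := hJ.to_subtype
  obtain ⟨f, hf⟩ := exists_surjective_nat (J × ℕ)
  refine ⟨fun k => (f k).1, fun k => (f k).1.2, fun e he => ?_⟩
  rw [Nat.frequently_atTop_iff_infinite]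
  refine Set.Infinite.of_image (fun k => (f k).2) ?_
  convert Set.infinite_univ (α := ℕ)
  refine Set.eq_univ_of_forall fun m => ?_
  obtain ⟨k, hk⟩ := hf (⟨e, he⟩, m)
  exact ⟨k, by simp [hk], by simp [hk]⟩

/-- The right end points of the blocks `E k < i ≤ E (k + 1)`; the `k`-th block has free digits up
to `g (E k)`, then enforces a visit to the target, and ends with one prescribed digit. -/
def blockEnd (g xi : ℕ → ℕ) : ℕ → ℕ
  | 0 => 0
  | k + 1 => g (blockEnd g xi k) + xi (g (blockEnd g xi k)) + 1

/-- The index of the block containing the position `i`. -/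
def blockIndex (g xi : ℕ → ℕ) (i : ℕ) : ℕ := Nat.findGreatest (fun k => blockEnd g xi k < i) i

/-- The digits allowed at position `i` of a block with free digits up to `n` and last digit `e`. -/
def blockDigits (b : ℕ) (J : Finset (ℕ × ℕ)) (ζ : ℕ → ℕ × ℕ) (lam xi : ℕ → ℕ) (n : ℕ) (e : ℕ × ℕ)
    (i : ℕ) : Finset (ℕ × ℕ) :=
  if i ≤ n then J else if i ≤ n + lam n then {ζ (i - n)}
  else if i ≤ n + xi n then J2 J (b - 1) else {e}

variable {b : ℕ} {J : Finset (ℕ × ℕ)}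

lemma strictMono_blockEnd {g xi : ℕ → ℕ} (hg : ∀ a, a < g a) : StrictMono (blockEnd g xi) :=
  strictMono_nat_of_lt_succ fun k => by
    have := hg (blockEnd g xi k)
    rw [blockEnd]
    omega

lemma blockIndex_eq {g xi : ℕ → ℕ} (hg : ∀ a, a < g a) {k i : ℕ} (h1 : blockEnd g xi k < i)
    (h2 : i ≤ blockEnd g xi (k + 1)) : blockIndex g xi i = k := by
  have hmono := strictMono_blockEnd (xi := xi) hg
  have hki : k ≤ i := hmono.le_apply.trans h1.le
  refine le_antisymm ?_ (Nat.le_findGreatest hki h1)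
  have h3 : blockEnd g xi (blockIndex g xi i) < i :=
    Nat.findGreatest_spec (P := fun k => blockEnd g xi k < i) hki h1
  exact Nat.lt_succ_iff.1 (hmono.lt_iff_lt.1 (h3.trans_le h2))

lemma blockDigits_subset {ζ : ℕ → ℕ × ℕ} (hζ : ∀ i, 1 ≤ i → ζ i ∈ J) {lam xi : ℕ → ℕ} {n : ℕ}
    {e : ℕ × ℕ} (he : e ∈ J) (i : ℕ) : blockDigits b J ζ lam xi n e i ⊆ J := by
  unfold blockDigits
  split_ifs
  · exact subset_rfl
  · exact Finset.singleton_subset_iff.2 (hζ _ (by omega))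
  · exact Finset.filter_subset _ _
  · exact Finset.singleton_subset_iff.2 he

lemma blockDigits_nonempty (hJ : J.Nonempty) (hrow : (J2 J (b - 1)).Nonempty) {ζ : ℕ → ℕ × ℕ}
    {lam xi : ℕ → ℕ} {n : ℕ} {e : ℕ × ℕ} (i : ℕ) :
    (blockDigits b J ζ lam xi n e i).Nonempty := by
  unfold blockDigits
  split_ifs
  · exact hJ
  · exact Finset.singleton_nonempty _
  · exact hrow
  · exact Finset.singleton_nonempty _

lemma le_dimH_targetSet (hb : 2 ≤ b) (hJ : ∀ e ∈ J, e.1 < b ∧ e.2 < b) (hJ0 : J.Nonempty)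
    (R : RepMap b J) {lam xi : ℕ → ℕ} (hle : ∀ n, lam n ≤ xi n) {l x : ℝ} (hl0 : 0 ≤ l)
    (hx0 : 0 ≤ x) (hl : Tendsto (fun n : ℕ => (lam n : ℝ) / n) atTop (𝓝 l))
    (hx : Tendsto (fun n : ℕ => (xi n : ℝ) / n) atTop (𝓝 x)) {ζ : ℕ → ℕ × ℕ}
    (hζ : ∀ i, 1 ≤ i → ζ i ∈ J) (hζrow : ∀ i, 1 ≤ i → (ζ i).2 = b - 1) {s : ℝ≥0} (hs : 0 < s)
    (hs1 : (s : ℝ) < Real.log J.card / Real.log b / (1 + l))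
    (hs2 : (s : ℝ) < (Real.log J.card / Real.log b +
      (x - l) * (Real.log (J2 J (b - 1)).card / Real.log b)) / (1 + x)) :
    (s : ℝ≥0∞) ≤ dimH (targetSet R lam xi (point b ζ).1 (point b ζ).2) := by
  have hb1 : (1 : ℝ) < b := by exact_mod_cast hb
  have hb0 : (0 : ℝ) < b := by linarith
  have hs0 : (0 : ℝ) < s := hs
  have hlogb : 0 < Real.log b := Real.log_pos hb1
  have hrow : (J2 J (b - 1)).Nonempty :=
    ⟨ζ 1, Finset.mem_filter.2 ⟨hζ 1 le_rfl, hζrow 1 le_rfl⟩⟩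
  have hgood : ∀ a, ∃ n, a < n ∧ ((b : ℝ) ^ (s : ℝ)) ^ (n + lam n + 1) ≤ (J.card : ℝ) ^ (n - a) ∧
      ((b : ℝ) ^ (s : ℝ)) ^ (n + xi n + 1) ≤
        (J.card : ℝ) ^ (n - a) * ((J2 J (b - 1)).card : ℝ) ^ (xi n - lam n) := by
    intro a
    have h1 := eventually_pow_le (s := s) hJ0.card_pos hrow.card_pos hb (fun n => le_refl (lam n))
      hl0 hl hl (by rwa [sub_self, zero_mul, add_zero]) a
    have h2 := eventually_pow_le (s := s) hJ0.card_pos hrow.card_pos hb hle hx0 hl hx hs2 a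
    obtain ⟨n, hn1, hn2, hn3⟩ := ((eventually_gt_atTop a).and (h1.and h2)).exists
    exact ⟨n, hn1, by simpa using hn2, hn3⟩
  choose g hg hg1 hg2 using hgood
  obtain ⟨c, hcJ, hc⟩ := exists_recurrent_enumeration J hJ0
  let E := blockEnd g xi
  let D : ℕ → Finset (ℕ × ℕ) := fun i =>
    blockDigits b J ζ lam xi (g (E (blockIndex g xi i))) (c (blockIndex g xi i)) i
  have hDJ : ∀ i, D i ⊆ J := fun i => blockDigits_subset hζ (hcJ _) i
  have hDne : ∀ i, (D i).Nonempty := fun i => blockDigits_nonempty hJ0 hrow i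
  have hE : ∀ k, E (k + 1) = g (E k) + xi (g (E k)) + 1 := fun k => rfl
  have hDblock : ∀ k i, E k < i → i ≤ g (E k) + xi (g (E k)) + 1 →
      D i = blockDigits b J ζ lam xi (g (E k)) (c k) i := by
    intro k i h1 h2
    simp only [D]
    rw [blockIndex_eq hg h1 h2]
  have ht : (1 : ℝ) ≤ (b : ℝ) ^ (s : ℝ) := Real.one_le_rpow hb1.le hs0.le
  have htK : (b : ℝ) ^ (s : ℝ) ≤ J.card := by
    have hk0 : (0 : ℝ) < J.card := by exact_mod_cast hJ0.card_pos
    have hγ : 0 ≤ Real.log J.card / Real.log b := div_nonneg (Real.log_natCast_nonneg _) hlogb.le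
    refine (Real.rpow_le_iff_le_log hb0 hk0).2 ((le_div_iff₀ hlogb).1 ?_)
    exact hs1.le.trans (div_le_self hγ (by linarith))
  refine le_dimH_of_digits hDne hb (fun i e he => hJ e (hDJ i he)) hs (fun N => ?_) ?_
  · rw [Real.rpow_mul hb0.le, Real.rpow_natCast]
    refine pow_le_prod_of_blocks (f := fun i => ((D i).card : ℝ)) (K := J.card)
      (B := (J2 J (b - 1)).card) (E := E) (n := fun k => g (E k)) (p := fun k => lam (g (E k)))
      (q := fun k => xi (g (E k))) (fun i => by exact_mod_cast (hDne i).card_pos) ht htK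
      (by exact_mod_cast hrow.card_pos) rfl hE (fun k => (hg _).le) (fun k => hle _) ?_ ?_
      (fun k => hg1 _) (fun k => hg2 _) N
    · intro k i h1 h2
      rw [hDblock k i h1 (by omega), blockDigits, if_pos h2]
    · intro k i h1 h2
      have := hg (E k)
      rw [hDblock k i (by omega) (by omega), blockDigits, if_neg (by omega), if_neg (by omega),
        if_pos h2]
  · intro d hd
    have hdJ : ∀ i, 1 ≤ i → d i ∈ J := fun i _ => hDJ i (hd i)
    have hmono : StrictMono E := strictMono_blockEnd hg
    have hrec : ∀ e ∈ J, ∃ᶠ i in atTop, d i = e := by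
      intro e he
      refine frequently_atTop.2 fun a => ?_
      obtain ⟨k, hk, hke⟩ := (frequently_atTop.1 (hc e he)) a
      refine ⟨E (k + 1), hk.trans ((Nat.le_succ k).trans hmono.le_apply), ?_⟩
      have h := hd (E (k + 1))
      have := hle (g (E k))
      rw [hDblock k _ (hmono (Nat.lt_succ_self k)) le_rfl, hE, blockDigits, if_neg (by omega),
        if_neg (by omega), if_neg (by omega), Finset.mem_singleton] at h
      rw [hE, h, hke]
    refine ⟨point_mem_carpet hdJ, frequently_atTop.2 fun a => ?_⟩
    have hga := hg (E a)
    have hdζ : ∀ i, 1 ≤ i → i ≤ lam (g (E a)) → d (i + g (E a)) = ζ i := by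
      intro i hi1 hi2
      have h := hd (i + g (E a))
      have := hle (g (E a))
      rw [hDblock a _ (by omega) (by omega), blockDigits, if_neg (by omega), if_pos (by omega),
        Finset.mem_singleton, Nat.add_sub_cancel] at h
      exact h
    have hdrow : ∀ i, 1 ≤ i → i ≤ xi (g (E a)) → (d (i + g (E a))).2 = (ζ i).2 := by
      intro i hi1 hi2
      rcases Nat.lt_or_ge (lam (g (E a))) i with hlt | hge
      · have h := hd (i + g (E a))
        rw [hDblock a _ (by omega) (by omega), blockDigits, if_neg (by omega), if_neg (by omega),
          if_pos (by omega)] at h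
        rw [(Finset.mem_filter.1 h).2, hζrow i hi1]
      · rw [hdζ i hi1 hge]
    refine ⟨g (E a), (hmono.le_apply.trans hga.le), ?_⟩
    rw [iterate_Tmap_point hb hJ R hdJ hrec]
    have h1 := abs_le.1 (abs_val_sub_val_le (u := fun i => (d (i + g (E a))).1)
      (v := fun i => (ζ i).1) hb (fun i hi => (hJ _ (hdJ _ (by omega))).1)
      (fun i hi => (hJ _ (hζ i hi)).1) fun i h1 h2 => by rw [hdζ i h1 h2])
    have h2 := abs_le.1 (abs_val_sub_val_le (u := fun i => (d (i + g (E a))).2)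
      (v := fun i => (ζ i).2) hb (fun i hi => (hJ _ (hdJ _ (by omega))).2)
      (fun i hi => (hJ _ (hζ i hi)).2) hdrow)
    simp only [point, mem_Icc]
    refine ⟨⟨?_, ?_⟩, ?_, ?_⟩ <;> linarith

end BlockConstruction

theorem stmt_15
    (b : ℕ) (J : Finset (ℕ × ℕ)) (hb : 2 ≤ b)
    (hJ : J ⊂ Finset.range b ×ˢ Finset.range b) (hJcard : 2 ≤ J.card)
    (R : RepMap b J) (lam xi : ℕ → ℕ)
    (hlam_pos : ∀ n, 1 ≤ lam n) (hle : ∀ n, lam n ≤ xi n)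
    (hlam_top : Tendsto lam atTop atTop)
    (l x : ℝ)
    (hl : Tendsto (fun n : ℕ => (lam n : ℝ) / n) atTop (𝓝 l))
    (hx : Tendsto (fun n : ℕ => (xi n : ℝ) / n) atTop (𝓝 x))
    (hlx : l < x)
    (z : ℝ) (hz : z ∈ Icc (0 : ℝ) 1) (hzw : ((z : ℝ), (1 : ℝ)) ∈ carpet b J) :
    dimH (targetSet R lam xi z 1) =
      ENNReal.ofReal (min ((Real.log J.card / Real.log b) / (1 + l))
        (((Real.log J.card / Real.log b) + (x - l) * (Real.log ((J2 J (b - 1)).card) / Real.log b)) / (1 + x))) := by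
  have hJ' : ∀ e ∈ J, e.1 < b ∧ e.2 < b := fun e he => by
    simpa using hJ.subset he
  have hJ0 : J.Nonempty := Finset.card_pos.1 (by omega)
  obtain ⟨ζ, hζ, hzeq⟩ := hzw
  obtain ⟨hz1, hz2⟩ := Prod.mk.inj hzeq
  have hζrow : ∀ i, 1 ≤ i → (ζ i).2 = b - 1 :=
    digit_eq_pred_of_val_eq_one hb (fun i hi => (hJ' _ (hζ i hi)).2) hz2.symm
  have hrow : 1 ≤ (J2 J (b - 1)).card :=
    Finset.card_pos.2 ⟨ζ 1, Finset.mem_filter.2 ⟨hζ 1 le_rfl, hζrow 1 le_rfl⟩⟩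
  have hl0 : 0 ≤ l := ge_of_tendsto' hl fun n => by positivity
  have hx0 : 0 ≤ x := hl0.trans hlx.le
  apply le_antisymm
  · have h1 := dimH_targetSet_le hb hJ' hJ0.card_pos hrow R hlam_pos (fun n => le_refl (lam n)) hle hl0
      hl hl z
    rw [sub_self, zero_mul, add_zero] at h1
    have h2 := dimH_targetSet_le hb hJ' hJ0.card_pos hrow R hlam_pos hle (fun n => le_refl (xi n)) hx0
      hl hx z
    rw [ENNReal.ofReal_min]
    exact le_min h1 h2
  · refine le_of_forall_lt fun a ha => ?_
    obtain ⟨s, has, hs⟩ := ENNReal.lt_iff_exists_nnreal_btwn.1 ha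
    have hs' := (ENNReal.lt_ofReal_iff_toReal_lt ENNReal.coe_ne_top).1 hs
    rw [ENNReal.coe_toReal, lt_min_iff] at hs'
    have h := le_dimH_targetSet hb hJ' hJ0 R hle hl0 hx0 hl hx hζ hζrow
      (ENNReal.coe_pos.1 (bot_le.trans_lt has)) hs'.1 hs'.2
    simp only [point, ← hz1, ← hz2] at h
    exact has.trans_le h

end ShrinkingRect
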